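/- Define f : ℝ → ℝ by f(x) = −x²/2 for x ≤ 0 and f(x) = x³/3 for x ≥ 0. Then f is continuously differentiable with f'(x) = −x for x ≤ 0 and f'(x) = x² for x ≥ 0, and for all real numbers v and z the following equivalence holds: limsup_{x → 0} (z·x − v·f'(x)) / (|x| + |f'(x)|) ≤ 0 if and only if −v ≤ z ≤ 0. In other words, the Fréchet second-order subdifferential of f at x̄ = 0 satisfies ∂̂²f(0)(v) = {z ∈ ℝ : −v ≤ z ≤ 0} for every v ∈ ℝ. -/

import Mathlib

open Filter Topology

theorem stmt_13 (f : ℝ → ℝ)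
    (hf : ∀ x : ℝ, f x = if x ≤ 0 then -x ^ 2 / 2 else x ^ 3 / 3) :
    ContDiff ℝ 1 f ∧
    (∀ x ≤ (0 : ℝ), deriv f x = -x) ∧
    (∀ x ≥ (0 : ℝ), deriv f x = x ^ 2) ∧
    (∀ v z : ℝ,
      (Filter.limsup (fun x => (z * x - v * deriv f x) / (|x| + |deriv f x|)) (𝓝[≠] 0) ≤ 0
        ↔ (-v ≤ z ∧ z ≤ 0))) := by
  have hfn : ∀ x ∈ Set.Iic (0:ℝ), f x = -x ^ 2 / 2 := by
    intro x hx
    rw [hf, if_pos (Set.mem_Iic.1 hx)]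
  have hfp : ∀ x ∈ Set.Ici (0:ℝ), f x = x ^ 3 / 3 := by
    intro x hx
    rw [hf]
    split_ifs with h
    · have : x = 0 := le_antisymm h hx
      subst this; norm_num
    · rfl
  have hL : ∀ x ≤ (0:ℝ), HasDerivWithinAt f (-x) (Set.Iic 0) x := by
    intro x hx
    have h : HasDerivAt (fun x : ℝ => -x ^ 2 / 2) (-x) x := by
      have := ((hasDerivAt_pow 2 x).neg).div_const 2
      refine HasDerivAt.congr_deriv this ?_
      push_cast
      ring
    exact h.hasDerivWithinAt.congr hfn (hfn x hx)
  have hR : ∀ x ≥ (0:ℝ), HasDerivWithinAt f (x ^ 2) (Set.Ici 0) x := by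
    intro x hx
    have h : HasDerivAt (fun x : ℝ => x ^ 3 / 3) (x ^ 2) x := by
      have := (hasDerivAt_pow 3 x).div_const 3
      refine HasDerivAt.congr_deriv this ?_
      push_cast
      ring
    exact h.hasDerivWithinAt.congr hfp (hfp x hx)
  have hD : ∀ x, HasDerivAt f (if x ≤ 0 then -x else x ^ 2) x := by
    intro x
    rcases lt_trichotomy x 0 with h | h | h
    · rw [if_pos h.le]
      exact (hL x h.le).hasDerivAt (Iic_mem_nhds h)
    · subst h
      have h1 := hL 0 le_rfl
      have h2 := hR 0 le_rfl
      have h3 : HasDerivWithinAt f 0 (Set.Iic 0 ∪ Set.Ici 0) 0 := by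
        refine HasDerivWithinAt.union ?_ ?_
        · simpa using h1
        · simpa using h2
      rw [Set.Iic_union_Ici, hasDerivWithinAt_univ] at h3
      simpa using h3
    · rw [if_neg h.not_ge]
      exact (hR x h.le).hasDerivAt (Ici_mem_nhds h)
  have hd : deriv f = fun x => if x ≤ 0 then -x else x ^ 2 := funext fun x => (hD x).deriv
  have hdn : ∀ x ≤ (0 : ℝ), deriv f x = -x := by
    intro x hx
    rw [hd]; simp [hx]
  have hdp : ∀ x ≥ (0 : ℝ), deriv f x = x ^ 2 := by
    intro x hx
    rcases hx.lt_or_eq with h | h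
    · rw [hd]; simp [h.not_ge]
    · rw [hd, ← h]; simp
  refine ⟨?_, hdn, hdp, ?_⟩
  · rw [contDiff_one_iff_deriv]
    refine ⟨fun x => (hD x).differentiableAt, ?_⟩
    rw [hd]
    refine Continuous.if_le (by fun_prop) (by fun_prop) (by fun_prop) (by fun_prop) ?_
    intro x hx
    rw [hx]; simp
  intro v z
  set q : ℝ → ℝ := fun x => (z * x - v * deriv f x) / (|x| + |deriv f x|) with hq
  have hqb : ∀ x, |q x| ≤ |z| + |v| := by
    intro x
    have h0 : 0 ≤ |x| + |deriv f x| := by positivity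
    simp only [hq, abs_div, abs_of_nonneg h0]
    refine div_le_of_le_mul₀ h0 (by positivity) ?_
    calc _ ≤ |z * x| + |v * deriv f x| := abs_sub _ _
      _ = |z| * |x| + |v| * |deriv f x| := by rw [abs_mul, abs_mul]
      _ ≤ _ := by
        nlinarith [mul_nonneg (abs_nonneg z) (abs_nonneg (deriv f x)),
          mul_nonneg (abs_nonneg v) (abs_nonneg x)]
  have hB : IsBoundedUnder (· ≤ ·) (𝓝[≠] (0:ℝ)) q :=
    isBoundedUnder_of ⟨_, fun x => (abs_le.1 (hqb x)).2⟩
  have hB' : IsBoundedUnder (· ≥ ·) (𝓝[≠] (0:ℝ)) q :=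
    isBoundedUnder_of ⟨_, fun x => (abs_le.1 (hqb x)).1⟩
  have hqn : ∀ x < 0, q x = -(z + v) / 2 := by
    intro x hx
    simp only [hq]
    rw [hdn x hx.le, abs_neg, abs_of_neg hx]
    have : x ≠ 0 := hx.ne
    rw [div_eq_div_iff (by intro h; apply this; linarith) (by norm_num)]
    ring
  have hqp : ∀ x > 0, q x = (z - v * x) / (1 + x) := by
    intro x hx
    simp only [hq]
    rw [hdp x hx.le, abs_of_pos hx, abs_of_pos (by positivity : 0 < x ^ 2)]
    rw [div_eq_div_iff (by positivity) (by positivity)]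
    ring
  have htp : Tendsto q (𝓝[>] 0) (𝓝 z) := by
    have h1 : Tendsto (fun x : ℝ => (z - v * x) / (1 + x)) (𝓝 0) (𝓝 z) := by
      have : ContinuousAt (fun x : ℝ => (z - v * x) / (1 + x)) 0 :=
        ContinuousAt.div (by fun_prop) (by fun_prop) (by norm_num)
      simpa [ContinuousAt] using this
    refine (h1.mono_left nhdsWithin_le_nhds).congr' ?_
    filter_upwards [self_mem_nhdsWithin] with x hx
    exact (hqp x hx).symm
  have hgt : 𝓝[>] (0:ℝ) ≤ 𝓝[≠] 0 := nhdsWithin_mono _ fun x hx => ne_of_gt hx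
  have hlt : 𝓝[<] (0:ℝ) ≤ 𝓝[≠] 0 := nhdsWithin_mono _ fun x hx => ne_of_lt hx
  constructor
  · intro h
    constructor
    · have : -(z + v) / 2 ≤ limsup q (𝓝[≠] 0) := by
        refine le_limsup_of_frequently_le ?_ hB
        refine Frequently.filter_mono (Eventually.frequently (f := 𝓝[<] (0:ℝ)) ?_) hlt
        filter_upwards [self_mem_nhdsWithin] with x hx
        exact (hqn x hx).ge
      linarith
    · by_contra! hz
      have : z / 2 ≤ limsup q (𝓝[≠] 0) := by
        refine le_limsup_of_frequently_le ?_ hB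
        refine Frequently.filter_mono (Eventually.frequently (f := 𝓝[>] (0:ℝ)) ?_) hgt
        exact htp.eventually (Ici_mem_nhds (by linarith))
      linarith
  · rintro ⟨h1, h2⟩
    refine le_of_forall_pos_le_add fun ε hε => ?_
    refine limsup_le_of_le hB'.isCoboundedUnder_le ?_
    rw [← nhdsLT_sup_nhdsGT, eventually_sup]
    constructor
    · filter_upwards [self_mem_nhdsWithin] with x hx
      rw [hqn x hx]; linarith
    · exact htp.eventually (Iic_mem_nhds (by linarith))
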